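/- arXiv:2203.04795 — 5 statements merged into one kernel-verified Lean document; each statement's English description precedes it below -/
import Mathlib

section
/- Trust never exceeds the equilibrium value regardless of behavior: let 0 < β < 1, let Δ ≥ 1 and d ≥ 1 be real numbers, and let S be a real number with 0 ≤ S ≤ min(d, Δ). If 0 ≤ T ≤ T* = Δ/(1 − β^Δ), then the general trust update satisfies T·β^d + S·min(1, d/Δ) ≤ T*. -/
/-- Trust never exceeds the equilibrium value regardless of behavior: let `0 < β < 1`,
`Δ ≥ 1`, `d ≥ 1`, and `0 ≤ S ≤ min(d, Δ)`. If `0 ≤ T ≤ T* = Δ/(1 − β^Δ)`, then the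
general trust update satisfies `T·β^d + S·min(1, d/Δ) ≤ T*`. -/
theorem trust_never_exceeds_equilibrium (β Δ d S T : ℝ) (hβ0 : 0 < β) (hβ1 : β < 1)
    (hΔ : 1 ≤ Δ) (hd : 1 ≤ d) (hS0 : 0 ≤ S) (hS : S ≤ min d Δ)
    (hT0 : 0 ≤ T) (hT : T ≤ Δ / (1 - β ^ Δ)) :
    T * β ^ d + S * min 1 (d / Δ) ≤ Δ / (1 - β ^ Δ) := by
  have hΔ0 : 0 < Δ := by linarith
  have hx1 : β ^ Δ < 1 := Real.rpow_lt_one hβ0.le hβ1 hΔ0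
  have hx0 : 0 < β ^ Δ := Real.rpow_pos_of_pos hβ0 Δ
  have hd0 : 0 < β ^ d := Real.rpow_pos_of_pos hβ0 d
  have hSd : S ≤ d := hS.trans (min_le_left _ _)
  have hSΔ : S ≤ Δ := hS.trans (min_le_right _ _)
  have hE : Δ / (1 - β ^ Δ) * (1 - β ^ Δ) = Δ := div_mul_cancel₀ _ (by linarith)
  have hE0 : 0 < Δ / (1 - β ^ Δ) := div_pos hΔ0 (by linarith)
  set E := Δ / (1 - β ^ Δ) with hEdef
  have h1 : T * β ^ d ≤ E * β ^ d := mul_le_mul_of_nonneg_right hT hd0.le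
  rcases le_total Δ d with h | h
  · have h2 : β ^ d ≤ β ^ Δ := Real.rpow_le_rpow_of_exponent_ge hβ0 hβ1.le h
    have h3 : S * min 1 (d / Δ) ≤ S * 1 := mul_le_mul_of_nonneg_left (min_le_left _ _) hS0
    have h4 : E * β ^ d ≤ E * β ^ Δ := mul_le_mul_of_nonneg_left h2 hE0.le
    linarith
  · have ht0 : 0 ≤ d / Δ := by positivity
    have ht1 : d / Δ ≤ 1 := (div_le_one hΔ0).2 h
    have h3 : S * min 1 (d / Δ) ≤ S * 1 := mul_le_mul_of_nonneg_left (min_le_left _ _) hS0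
    have hb := rpow_one_add_le_one_add_mul_self (s := β ^ Δ - 1) (by linarith) ht0 ht1
    have he : (1 + (β ^ Δ - 1)) ^ (d / Δ) = β ^ d := by
      rw [add_sub_cancel, ← Real.rpow_mul hβ0.le, mul_div_cancel₀ _ hΔ0.ne']
    rw [he] at hb
    have h4 := mul_le_mul_of_nonneg_left hb hE0.le
    have h5 : E * (1 + d / Δ * (β ^ Δ - 1)) = E - d := by
      have : d / Δ * Δ = d := div_mul_cancel₀ _ hΔ0.ne'
      linear_combination (-(d / Δ)) * hE - this
    linarith
end

section
/- Theorem (incentive to be honest): let N be a finite set of peers, M ⊆ M ⊆ N a sync list with peer 1 ∈ M, let T̄ : N → ℝ assign each peer a nonnegative hypothetical trust with total L = Σ_{i ∈ N} T̄_i > 0, and let S > 0 be the number of successful primaries. Define peer 1's fractional trust under honesty as 𝒯₁ = (T̄₁ + S) / (Σ_{i ∈ M} (T̄_i + S) + Σ_{j ∈ N \ M} T̄_j) and its hypothetical fractional trust under sabotage as 𝒯̄₁ = T̄₁ / L. Then 𝒯̄₁ ≤ 𝒯₁ if and only if |M| · 𝒯̄₁ ≤ 1. -/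
/-- Theorem (incentive to be honest): let `N` be a finite set of peers, `M ⊆ N` a
sync list containing peer `p`, let `T̄` assign each peer a nonnegative hypothetical
trust with total `L = Σ_{i ∈ N} T̄ i > 0`, and let `S > 0` be the number of
successful primaries. Define peer `p`'s fractional trust under honesty as
`(T̄ p + S) / (Σ_{i ∈ M} (T̄ i + S) + Σ_{j ∈ N \ M} T̄ j)` and its hypothetical
fractional trust under sabotage as `T̄ p / L`. Then the sabotage fractional trust is
at most the honest one if and only if `|M| · (T̄ p / L) ≤ 1`. -/
theorem incentive_to_be_honest {ι : Type*} [DecidableEq ι] (N M : Finset ι)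
    (hMN : M ⊆ N) (p : ι) (hp : p ∈ M)
    (Tbar : ι → ℝ) (hTnonneg : ∀ i ∈ N, 0 ≤ Tbar i)
    (L : ℝ) (hL : L = ∑ i ∈ N, Tbar i) (hLpos : 0 < L)
    (S : ℝ) (hS : 0 < S) :
    Tbar p / L ≤ (Tbar p + S) / (∑ i ∈ M, (Tbar i + S) + ∑ j ∈ N \ M, Tbar j) ↔
      (M.card : ℝ) * (Tbar p / L) ≤ 1 := by
  have hD : ∑ i ∈ M, (Tbar i + S) + ∑ j ∈ N \ M, Tbar j = L + (M.card : ℝ) * S := by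
    rw [Finset.sum_add_distrib, Finset.sum_const, nsmul_eq_mul, hL,
      ← Finset.sum_sdiff hMN]
    ring
  have hDpos : 0 < L + (M.card : ℝ) * S := by positivity
  rw [hD, div_le_div_iff₀ hLpos hDpos, ← mul_div_assoc, div_le_one hLpos]
  constructor
  · intro h
    refine le_of_mul_le_mul_right ?_ hS
    linarith
  · intro h
    have h2 := mul_le_mul_of_nonneg_right h hS.le
    linarith
end

section
/- Corollary (sync list size bound prevents exploitation): let 0 < β < 1, Δ ≥ 1, let N be a finite set of peers with nonnegative hypothetical trusts T̄ : N → ℝ, total L = Σ_{i ∈ N} T̄_i > 0, such that every peer satisfies T̄_i ≤ T* = Δ/(1 − β^Δ). Let M ⊆ N be a sync list containing peer 1, and S > 0. If |M| ≤ L·(1 − β^Δ)/Δ, then T̄₁/L ≤ (T̄₁ + S) / (Σ_{i ∈ M} (T̄_i + S) + Σ_{j ∈ N \ M} T̄_j); that is, every peer in M is incentivized to be honest. -/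
/-- Corollary (sync list size bound prevents exploitation): let `0 < β < 1`, `Δ ≥ 1`,
`N` a finite set of peers with nonnegative hypothetical trusts, total
`L = Σ_{i ∈ N} T̄ i > 0`, every peer's trust bounded by `T* = Δ/(1 − β^Δ)`.
Let `M ⊆ N` be a sync list containing peer `p`, and `S > 0`.
If `|M| ≤ L·(1 − β^Δ)/Δ`, then peer `p` is incentivized to be honest. -/
theorem sync_list_size_bound_prevents_exploitation {ι : Type*} [DecidableEq ι]
    (β Δ : ℝ) (hβ0 : 0 < β) (hβ1 : β < 1) (hΔ : 1 ≤ Δ)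
    (N M : Finset ι) (hMN : M ⊆ N) (p : ι) (hp : p ∈ M)
    (Tbar : ι → ℝ) (hTnonneg : ∀ i ∈ N, 0 ≤ Tbar i)
    (hTbound : ∀ i ∈ N, Tbar i ≤ Δ / (1 - β ^ Δ))
    (L : ℝ) (hL : L = ∑ i ∈ N, Tbar i) (hLpos : 0 < L)
    (S : ℝ) (hS : 0 < S)
    (hsize : (M.card : ℝ) ≤ L * (1 - β ^ Δ) / Δ) :
    Tbar p / L ≤ (Tbar p + S) / (∑ i ∈ M, (Tbar i + S) + ∑ j ∈ N \ M, Tbar j) := by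
  have hlt : β ^ Δ < 1 := Real.rpow_lt_one hβ0.le hβ1 (by linarith)
  have hpos : 0 < 1 - β ^ Δ := by linarith
  have hΔpos : 0 < Δ := by linarith
  have hden : ∑ i ∈ M, (Tbar i + S) + ∑ j ∈ N \ M, Tbar j = L + M.card * S := by
    rw [Finset.sum_add_distrib, Finset.sum_const, nsmul_eq_mul, hL,
      ← Finset.sum_sdiff hMN]
    ring
  have hm : (0 : ℝ) ≤ M.card := Nat.cast_nonneg _
  have hTm : Tbar p * M.card ≤ L := by
    have h1 := hTbound p (hMN hp)
    calc Tbar p * M.card ≤ Δ / (1 - β ^ Δ) * M.card :=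
          mul_le_mul_of_nonneg_right h1 hm
      _ ≤ Δ / (1 - β ^ Δ) * (L * (1 - β ^ Δ) / Δ) :=
          mul_le_mul_of_nonneg_left hsize (by positivity)
      _ = L := by
          have := hpos.ne'
          field_simp
  rw [hden, div_le_div_iff₀ hLpos (by positivity)]
  nlinarith [mul_le_mul_of_nonneg_right hTm hS.le]
end

section
/- Corollary (average-performance bound): let 0 < β < 1, Δ ≥ 1, let N be a nonempty finite set of peers with nonnegative hypothetical trusts T̄ : N → ℝ, total L = Σ_{i ∈ N} T̄_i > 0 and average T_ave = L/|N|, such that every peer satisfies T̄_i ≤ T* = Δ/(1 − β^Δ). Let M ⊆ N be a sync list containing peer 1, and S > 0. If |M| ≤ |N|·T_ave/T*, then T̄₁/L ≤ (T̄₁ + S) / (Σ_{i ∈ M} (T̄_i + S) + Σ_{j ∈ N \ M} T̄_j); that is, every peer in M is incentivized to be honest. -/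
/-- Corollary (average-performance bound): let `0 < β < 1`, `Δ ≥ 1`, `N` a nonempty
finite set of peers with nonnegative hypothetical trusts, total
`L = Σ_{i ∈ N} T̄ i > 0` and average `T_ave = L/|N|`, every peer's trust bounded by
`T* = Δ/(1 − β^Δ)`. Let `M ⊆ N` be a sync list containing peer `p`, and `S > 0`.
If `|M| ≤ |N|·T_ave/T*`, then peer `p` is incentivized to be honest. -/
theorem average_performance_bound {ι : Type*} [DecidableEq ι]
    (β Δ : ℝ) (hβ0 : 0 < β) (hβ1 : β < 1) (hΔ : 1 ≤ Δ)
    (N M : Finset ι) (hN : N.Nonempty) (hMN : M ⊆ N) (p : ι) (hp : p ∈ M)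
    (Tbar : ι → ℝ) (hTnonneg : ∀ i ∈ N, 0 ≤ Tbar i)
    (hTbound : ∀ i ∈ N, Tbar i ≤ Δ / (1 - β ^ Δ))
    (L : ℝ) (hL : L = ∑ i ∈ N, Tbar i) (hLpos : 0 < L)
    (Tave : ℝ) (hTave : Tave = L / (N.card : ℝ))
    (S : ℝ) (hS : 0 < S)
    (hsize : (M.card : ℝ) ≤ (N.card : ℝ) * Tave / (Δ / (1 - β ^ Δ))) :
    Tbar p / L ≤ (Tbar p + S) / (∑ i ∈ M, (Tbar i + S) + ∑ j ∈ N \ M, Tbar j) := by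
  have hpow : β ^ Δ < 1 := Real.rpow_lt_one hβ0.le hβ1 (by linarith)
  have hT : 0 < Δ / (1 - β ^ Δ) := div_pos (by linarith) (by linarith)
  have hc : (0 : ℝ) < (N.card : ℝ) := by exact_mod_cast hN.card_pos
  have hNT : (N.card : ℝ) * Tave = L := by
    rw [hTave]
    field_simp
  rw [hNT, le_div_iff₀ hT] at hsize
  have hden : ∑ i ∈ M, (Tbar i + S) + ∑ j ∈ N \ M, Tbar j = L + (M.card : ℝ) * S := by
    rw [hL, ← Finset.sum_sdiff hMN, Finset.sum_add_distrib, Finset.sum_const, nsmul_eq_mul]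
    ring
  have hm : (0 : ℝ) ≤ (M.card : ℝ) := Nat.cast_nonneg _
  have hb : (M.card : ℝ) * Tbar p ≤ L :=
    (mul_le_mul_of_nonneg_left (hTbound p (hMN hp)) hm).trans hsize
  have hmS : 0 ≤ (M.card : ℝ) * S := mul_nonneg hm hS.le
  rw [hden, div_le_div_iff₀ hLpos (by linarith)]
  have := mul_le_mul_of_nonneg_right hb hS.le
  linarith
end

section
/- Early bridging is penalized relative to waiting for the max bridge interval: let 0 < β < 1 and Δ ≥ 1, and let 1 ≤ d ≤ Δ with d the number of prime steps since the last bridge and S = d the number of successful primaries (perfect primary performance). Then for any trust value 0 ≤ T ≤ T* = Δ/(1 − β^Δ), the early-bridge update satisfies T·β^d + d·(d/Δ) ≤ T·β^Δ + Δ; that is, bridging early at time d yields no more trust than performing a perfect bridge at the max bridge interval. -/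
/-- Early bridging is penalized relative to waiting for the max bridge interval:
let `0 < β < 1`, `Δ ≥ 1`, `1 ≤ d ≤ Δ` and suppose perfect primary performance
(`S = d`). Then for any trust value `0 ≤ T ≤ T* = Δ/(1 − β^Δ)`, the early-bridge
update satisfies `T·β^d + d·(d/Δ) ≤ T·β^Δ + Δ`. -/
theorem early_bridging_penalized (β Δ d T : ℝ) (hβ0 : 0 < β) (hβ1 : β < 1)
    (hΔ : 1 ≤ Δ) (hd : 1 ≤ d) (hdΔ : d ≤ Δ)
    (hT0 : 0 ≤ T) (hT : T ≤ Δ / (1 - β ^ Δ)) :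
    T * β ^ d + d * (d / Δ) ≤ T * β ^ Δ + Δ := by
  have hΔ0 : 0 < Δ := by linarith
  have hq1 : β ^ Δ < 1 := Real.rpow_lt_one hβ0.le hβ1 hΔ0
  have hq0 : 0 < β ^ Δ := Real.rpow_pos_of_pos hβ0 Δ
  obtain ⟨x, hx⟩ : ∃ x, x = d / Δ := ⟨_, rfl⟩
  have hdx : d = Δ * x := by rw [hx]; field_simp
  have hx0 : 0 ≤ x := by rw [hx]; positivity
  have hx1 : x ≤ 1 := by rw [hx, div_le_one hΔ0]; exact hdΔ
  have key := rpow_one_add_le_one_add_mul_self (s := β ^ Δ - 1) (by linarith) hx0 hx1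
  rw [add_sub_cancel, ← Real.rpow_mul hβ0.le, ← hdx] at key
  rw [le_div_iff₀ (by linarith)] at hT
  rw [← hx]
  have h1 : T * β ^ d ≤ T * (1 + x * (β ^ Δ - 1)) := mul_le_mul_of_nonneg_left key hT0
  have h2 : (1 - x) * (T * (1 - β ^ Δ)) ≤ (1 - x) * Δ :=
    mul_le_mul_of_nonneg_left hT (by linarith)
  have h3 : d * x ≤ Δ * x := mul_le_mul_of_nonneg_right hdΔ hx0
  nlinarith
end
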